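/- Let G ∈ 𝒢₁(n, n−3) with n ≥ 5, and let v₁v₂v₃v₄ be an induced path P₄ in G. If u₂ is a vertex such that v₁u₂v₃v₄ is also an induced path P₄ in G, then d_{u₂} = d_{v₂} (the degrees of u₂ and v₂ in G are equal). -/

import Mathlib

open Matrix

/-- The normalized Laplacian matrix of a finite simple graph. -/
noncomputable def normLap {V : Type*} [Fintype V] [DecidableEq V] (G : SimpleGraph V) [DecidableRel G.Adj] :
    Matrix V V ℝ :=
  Matrix.of fun u v =>
    if u = v then 1
    else if G.Adj u v then -1 / Real.sqrt ((G.degree u : ℝ) * (G.degree v : ℝ))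
    else 0

/-- The (geometric) multiplicity of `μ` as an eigenvalue of the matrix `M`. -/
noncomputable def eigMult {V : Type*} [Fintype V] [DecidableEq V]
    (M : Matrix V V ℝ) (μ : ℝ) : ℕ :=
  Module.finrank ℝ (LinearMap.ker (M - μ • (1 : Matrix V V ℝ)).mulVecLin)

/-- The multiset of eigenvalues (with multiplicity) of a hermitian matrix. -/
noncomputable def eigMultiset {V : Type*} [Fintype V] [DecidableEq V]
    (M : Matrix V V ℝ) : Multiset ℝ :=
  if h : M.IsHermitian then Finset.univ.val.map h.eigenvalues else 0

/-- The second-smallest eigenvalue (counted with multiplicity) of a hermitian matrix. -/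
noncomputable def secondSmallestEig {V : Type*} [Fintype V] [DecidableEq V]
    (M : Matrix V V ℝ) : ℝ :=
  ((eigMultiset M).sort (· ≤ ·)).getD 1 0

/-- The independence number of a finite simple graph. -/
noncomputable def indepNum {V : Type*} [Fintype V] (G : SimpleGraph V) : ℕ :=
  sSup {k | ∃ s : Finset V, (∀ u ∈ s, ∀ v ∈ s, u ≠ v → ¬ G.Adj u v) ∧ s.card = k}

/-- `G ∈ 𝒢₁(n, n-3)`. -/
def memG1Family {V : Type*} [Fintype V] [DecidableEq V]
    (G : SimpleGraph V) [DecidableRel G.Adj] (n : ℕ) : Prop :=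
  G.Connected ∧ Fintype.card V = n ∧
    (∃ θ : ℝ, eigMult (normLap G) θ = n - 3) ∧
    secondSmallestEig (normLap G) ≠ 1 ∧
    indepNum G = 2

/-- `v₁v₂v₃v₄` is an induced path `P₄`. -/
def IsInducedP4 {V : Type*} (G : SimpleGraph V) (v1 v2 v3 v4 : V) : Prop :=
  G.Adj v1 v2 ∧ G.Adj v2 v3 ∧ G.Adj v3 v4 ∧
    ¬ G.Adj v1 v3 ∧ ¬ G.Adj v1 v4 ∧ ¬ G.Adj v2 v4

/-- A cograph: no induced path on 4 vertices. -/
def IsCograph {V : Type*} (G : SimpleGraph V) : Prop :=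
  ∀ a b c d : V, ¬ IsInducedP4 G a b c d

/-- `S_U`: vertices outside the path `P` whose neighborhood inside `P` is exactly `U`. -/
def Sset {V : Type*} (G : SimpleGraph V) (P U : Set V) : Set V :=
  {u | u ∉ P ∧ G.neighborSet u ∩ P = U}

/-- The graph `G₁`: two cliques `A` (of size `a+1`) and `B` (of size `b+1`) forming a complete
graph together, a vertex `u` joined to all of `A` and a vertex `w` joined to all of `B`. -/
def graphG1 (a b : ℕ) : SimpleGraph (Unit ⊕ (Fin (a + 1) ⊕ (Fin (b + 1) ⊕ Unit))) :=
  SimpleGraph.fromRel fun x y =>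
    match x, y with
    | Sum.inl _, Sum.inr (Sum.inl _) => True
    | Sum.inr (Sum.inl _), Sum.inr (Sum.inl _) => True
    | Sum.inr (Sum.inl _), Sum.inr (Sum.inr (Sum.inl _)) => True
    | Sum.inr (Sum.inr (Sum.inl _)), Sum.inr (Sum.inr (Sum.inl _)) => True
    | Sum.inr (Sum.inr (Sum.inl _)), Sum.inr (Sum.inr (Sum.inr _)) => True
    | _, _ => False

noncomputable instance (a b : ℕ) : DecidableRel (graphG1 a b).Adj := Classical.decRel _

/-- The graph `G₂` on `m + 2` vertices: a complete graph on `m + 1` vertices together with a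
pendant vertex attached to one of its vertices. -/
def graphG2 (m : ℕ) : SimpleGraph (Unit ⊕ Fin (m + 1)) :=
  SimpleGraph.fromRel fun x y =>
    match x, y with
    | Sum.inl _, Sum.inr j => j = 0
    | Sum.inr _, Sum.inr _ => True
    | _, _ => False

noncomputable instance (m : ℕ) : DecidableRel (graphG2 m).Adj := Classical.decRel _

/-- The join of a single vertex with the disjoint union of two complete graphs `K_m`. -/
def joinTwoCliques (m : ℕ) : SimpleGraph (Unit ⊕ (Fin m ⊕ Fin m)) :=
  SimpleGraph.fromRel fun x y =>
    match x, y with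
    | Sum.inl _, Sum.inr _ => True
    | Sum.inr (Sum.inl _), Sum.inr (Sum.inl _) => True
    | Sum.inr (Sum.inr _), Sum.inr (Sum.inr _) => True
    | _, _ => False

noncomputable instance (m : ℕ) : DecidableRel (joinTwoCliques m).Adj := Classical.decRel _

/-- The matrix `(1 - θ) D - A`, where `D` is the degree matrix and `A` the adjacency matrix. -/
noncomputable def shiftedLap {V : Type*} [Fintype V] [DecidableEq V] (G : SimpleGraph V)
    [DecidableRel G.Adj] (θ : ℝ) : Matrix V V ℝ :=
  Matrix.of fun u v => if u = v then (1 - θ) * G.degree u else if G.Adj u v then -1 else 0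

theorem shiftedLap_eq {V : Type*} [Fintype V] [DecidableEq V] (G : SimpleGraph V)
    [DecidableRel G.Adj] (θ : ℝ) :
    shiftedLap G θ = Matrix.diagonal (fun u => √(G.degree u : ℝ)) *
      (normLap G - θ • (1 : Matrix V V ℝ)) * Matrix.diagonal (fun u => √(G.degree u : ℝ)) := by
  ext u v
  rw [Matrix.mul_diagonal, Matrix.diagonal_mul]
  by_cases huv : u = v
  · subst huv
    have h : √(G.degree u : ℝ) * √(G.degree u : ℝ) = G.degree u :=
      Real.mul_self_sqrt (Nat.cast_nonneg _)
    simp only [shiftedLap, normLap, Matrix.of_apply, if_true, Matrix.sub_apply, Matrix.smul_apply,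
      Matrix.one_apply_eq, smul_eq_mul, mul_one]
    linear_combination -(1 - θ) * h
  · by_cases hadj : G.Adj u v
    · have hu : 0 < √(G.degree u : ℝ) :=
        Real.sqrt_pos.2 (Nat.cast_pos.2 ((G.degree_pos_iff_exists_adj u).2 ⟨v, hadj⟩))
      have hv : 0 < √(G.degree v : ℝ) :=
        Real.sqrt_pos.2 (Nat.cast_pos.2 ((G.degree_pos_iff_exists_adj v).2 ⟨u, hadj.symm⟩))
      simp only [shiftedLap, normLap, Matrix.of_apply, if_neg huv, if_pos hadj, Matrix.sub_apply,
        Matrix.smul_apply, Matrix.one_apply_ne huv, smul_zero, sub_zero,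
        Real.sqrt_mul (Nat.cast_nonneg (G.degree u))]
      field_simp
    · simp [shiftedLap, normLap, huv, hadj]

theorem rank_shiftedLap_add_eigMult_le {V : Type*} [Fintype V] [DecidableEq V]
    (G : SimpleGraph V) [DecidableRel G.Adj] (θ : ℝ) :
    (shiftedLap G θ).rank + eigMult (normLap G) θ ≤ Fintype.card V := by
  have h := LinearMap.finrank_range_add_finrank_ker
    (normLap G - θ • (1 : Matrix V V ℝ)).mulVecLin
  rw [Module.finrank_fintype_fun_eq_card] at h
  rw [← h, shiftedLap_eq]
  exact Nat.add_le_add_right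
    ((Matrix.rank_mul_le_left _ _).trans (Matrix.rank_mul_le_right _ _)) _

theorem det_submatrix_eq_zero_of_rank_lt {m K : Type*} [Fintype m] [Field K] {k : ℕ}
    (M : Matrix m m K) (r c : Fin k → m) (h : M.rank < k) : (M.submatrix r c).det = 0 := by
  by_contra hdet
  have hrank := Matrix.rank_of_isUnit _ ((Matrix.isUnit_iff_isUnit_det _).2 (Ne.isUnit hdet))
  have hle := Matrix.rank_submatrix_le M r c
  rw [hrank, Fintype.card_fin] at hle
  omega

/-- The principal minor of `(1 - θ) D - A` on an induced path, as a vanishing continuant. -/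
theorem IsInducedP4.continuant_eq_zero {V : Type*} [Fintype V] [DecidableEq V]
    {G : SimpleGraph V} [DecidableRel G.Adj] {θ : ℝ} (hr : (shiftedLap G θ).rank < 4)
    {a b c d : V} (h : IsInducedP4 G a b c d) :
    ((1 - θ) * G.degree a) * ((1 - θ) * G.degree b) * ((1 - θ) * G.degree c) *
        ((1 - θ) * G.degree d)
      - ((1 - θ) * G.degree c) * ((1 - θ) * G.degree d)
      - ((1 - θ) * G.degree a) * ((1 - θ) * G.degree d)
      - ((1 - θ) * G.degree a) * ((1 - θ) * G.degree b) + 1 = 0 := by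
  obtain ⟨hab, hbc, hcd, hac, had, hbd⟩ := h
  have nac : a ≠ c := by rintro rfl; exact had hcd
  have nad : a ≠ d := by rintro rfl; exact hac hcd.symm
  have nbd : b ≠ d := by rintro rfl; exact had hab
  have hdet := det_submatrix_eq_zero_of_rank_lt (shiftedLap G θ) ![a, b, c, d] ![a, b, c, d] hr
  have hM : (shiftedLap G θ).submatrix ![a, b, c, d] ![a, b, c, d] =
      !![(1 - θ) * G.degree a, -1, 0, 0; -1, (1 - θ) * G.degree b, -1, 0;
        0, -1, (1 - θ) * G.degree c, -1; 0, 0, -1, (1 - θ) * G.degree d] := by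
    ext i j
    fin_cases i <;> fin_cases j <;>
      simp [shiftedLap, hab, hbc, hcd, hac, had, hbd, hab.symm, hbc.symm, hcd.symm, hab.ne, hbc.ne,
        hcd.ne, hab.ne', hbc.ne', hcd.ne', nac, nad, nbd, nac.symm, nad.symm, nbd.symm,
        G.adj_comm c a, G.adj_comm d a, G.adj_comm d b]
  rw [hM] at hdet
  simp [Matrix.det_succ_row_zero, Fin.sum_univ_succ, Fin.succAbove] at hdet
  linear_combination hdet

theorem statement3 {V : Type*} [Fintype V] [DecidableEq V] (n : ℕ) (hn : 5 ≤ n)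
    (G : SimpleGraph V) [DecidableRel G.Adj] (hG : memG1Family G n)
    (v1 v2 v3 v4 u2 : V)
    (hP : IsInducedP4 G v1 v2 v3 v4) (hP' : IsInducedP4 G v1 u2 v3 v4) :
    G.degree u2 = G.degree v2 := by
  obtain ⟨-, hcard, ⟨θ, hθ⟩, -, -⟩ := hG
  have hr : (shiftedLap G θ).rank < 4 := by
    have := rank_shiftedLap_add_eigMult_le G θ
    omega
  have e := hP.continuant_eq_zero hr
  have e' := hP'.continuant_eq_zero hr
  have h1 : (G.degree v1 : ℝ) ≠ 0 :=
    Nat.cast_ne_zero.2 ((G.degree_pos_iff_exists_adj v1).2 ⟨v2, hP.1⟩).ne'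
  have h4 : (G.degree v4 : ℝ) ≠ 0 :=
    Nat.cast_ne_zero.2 ((G.degree_pos_iff_exists_adj v4).2 ⟨v3, hP.2.2.1.symm⟩).ne'
  have hx : 1 - θ ≠ 0 := by
    intro hx
    simp [hx] at e
  have hprod : ((1 - θ) * G.degree v3) * ((1 - θ) * G.degree v4) - 1 ≠ 0 := by
    intro h
    refine mul_ne_zero (mul_ne_zero hx h1) (mul_ne_zero hx h4) ?_
    linear_combination -e + (((1 - θ) * G.degree v1) * ((1 - θ) * G.degree v2) - 1) * h
  have key : ((1 - θ) * G.degree v1) * (1 - θ) *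
      (((1 - θ) * G.degree v3) * ((1 - θ) * G.degree v4) - 1) *
      ((G.degree u2 : ℝ) - G.degree v2) = 0 := by
    linear_combination e' - e
  have hsub := (mul_eq_zero.1 key).resolve_left
    (mul_ne_zero (mul_ne_zero (mul_ne_zero hx h1) hx) hprod)
  exact_mod_cast sub_eq_zero.1 hsub
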